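/- arXiv:2109.09123 — 5 statements merged into one kernel-verified Lean document; each statement's English description precedes it below -/
import Mathlib

section
/- If T is an m-accretive operator on a complex Hilbert space H, then its Moore-Penrose inverse T† is m-accretive. -/
open scoped ComplexInnerProductSpace
noncomputable section

variable {H : Type*} [NormedAddCommGroup H] [InnerProductSpace ℂ H] [CompleteSpace H]

/-- The range of a partially defined operator, as a submodule of `H`. -/
def pRange (T : H →ₗ.[ℂ] H) : Submodule ℂ H := LinearMap.range T.toFun

/-- The kernel of a partially defined operator, as a submodule of `H`. -/
def pKer (T : H →ₗ.[ℂ] H) : Submodule ℂ H := (LinearMap.ker T.toFun).map T.domain.subtype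

/-- An operator `T` is accretive if `Re ⟨T x, x⟩ ≥ 0` for all `x` in its domain. -/
def PAccretive (T : H →ₗ.[ℂ] H) : Prop := ∀ x : T.domain, 0 ≤ (⟪(x : H), T x⟫).re

/-- `T` is m-accretive: accretive, densely defined, closed, and `R(μ + T) = H` for all `μ > 0`. -/
def MAccretive (T : H →ₗ.[ℂ] H) : Prop :=
  PAccretive T ∧ Dense (T.domain : Set H) ∧ IsClosed (T.graph : Set (H × H)) ∧
    ∀ μ : ℝ, 0 < μ → ∀ y : H, ∃ x : T.domain, (μ : ℂ) • (x : H) + T x = y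

/-- `T` is sectorial with vertex `0` and semiangle `ω` (ω-accretive):
`W(T) ⊆ {z : |arg z| ≤ ω}`. -/
def SectorialP (T : H →ₗ.[ℂ] H) (ω : ℝ) : Prop :=
  ∀ x : T.domain, ‖(x : H)‖ = 1 → |(⟪(x : H), T x⟫).arg| ≤ ω

/-- `y` is the orthogonal projection of `x` onto the closure of `M`. -/
def IsProjOnto (M : Submodule ℂ H) (x y : H) : Prop :=
  y ∈ M.topologicalClosure ∧ x - y ∈ Mᗮ

/-- `Td` is the Moore-Penrose inverse of `T`: a closed densely defined operator with
domain `R(T) ⊕ R(T)ᗮ` such that `T Td T = T` on `D(T)`, `Td T Td = Td` on `D(Td)`,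
`T Td = P_{cl R(T)}` on `D(Td)` and `Td T = P_{N(T)ᗮ}` on `D(T)`. -/
structure IsMoorePenroseInverse (T Td : H →ₗ.[ℂ] H) : Prop where
  closed' : IsClosed (Td.graph : Set (H × H))
  dense' : Dense (Td.domain : Set H)
  domain_eq : Td.domain = pRange T ⊔ (pRange T)ᗮ
  tdt : ∀ x : T.domain, ∃ (h1 : T x ∈ Td.domain) (h2 : Td ⟨T x, h1⟩ ∈ T.domain),
    T ⟨Td ⟨T x, h1⟩, h2⟩ = T x
  dtd : ∀ x : Td.domain, ∃ (h1 : Td x ∈ T.domain) (h2 : T ⟨Td x, h1⟩ ∈ Td.domain),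
    Td ⟨T ⟨Td x, h1⟩, h2⟩ = Td x
  proj_range : ∀ x : Td.domain, ∃ h1 : Td x ∈ T.domain,
    IsProjOnto (pRange T) (x : H) (T ⟨Td x, h1⟩)
  proj_ker : ∀ x : T.domain, ∃ h1 : T x ∈ Td.domain,
    IsProjOnto ((pKer T)ᗮ) (x : H) (Td ⟨T x, h1⟩)

/-- A bounded everywhere-defined operator viewed as a partially defined operator. -/
def clmToPMap (S : H →L[ℂ] H) : H →ₗ.[ℂ] H := S.toLinearMap.toPMap ⊤

/-- A partially defined operator is bounded if it is bounded on its domain. -/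
def BoundedPMap (T : H →ₗ.[ℂ] H) : Prop := ∃ C : ℝ, ∀ x : T.domain, ‖T x‖ ≤ C * ‖(x : H)‖

/-- `T Td = Td T` on `D(T)`. -/
def CommutesOnDomain (T Td : H →ₗ.[ℂ] H) : Prop :=
  ∀ x : T.domain, ∃ (h1 : (x : H) ∈ Td.domain) (h2 : Td ⟨(x : H), h1⟩ ∈ T.domain)
    (h3 : T x ∈ Td.domain), T ⟨Td ⟨(x : H), h1⟩, h2⟩ = Td ⟨T x, h3⟩

/-- `T` is an EP operator: its Moore-Penrose inverse is bounded and `T T† = T† T` on `D(T)`. -/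
def IsEPPMap (T : H →ₗ.[ℂ] H) : Prop :=
  ∃ Td : H →ₗ.[ℂ] H, IsMoorePenroseInverse T Td ∧ BoundedPMap Td ∧ CommutesOnDomain T Td

/-- The sum `T + S` of a partially defined operator and a bounded operator, with domain `D(T)`. -/
def addB (T : H →ₗ.[ℂ] H) (S : H →L[ℂ] H) : H →ₗ.[ℂ] H :=
  ⟨T.domain, T.toFun + S.toLinearMap.comp T.domain.subtype⟩

/-- The sum of two partially defined operators, with domain `D(A) ∩ D(B)`. -/
def pAdd (A B : H →ₗ.[ℂ] H) : H →ₗ.[ℂ] H :=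
  ⟨A.domain ⊓ B.domain,
    A.toFun.comp (Submodule.inclusion inf_le_left) +
      B.toFun.comp (Submodule.inclusion inf_le_right)⟩

/-- The difference of two partially defined operators, with domain `D(A) ∩ D(B)`. -/
def pSub (A B : H →ₗ.[ℂ] H) : H →ₗ.[ℂ] H :=
  ⟨A.domain ⊓ B.domain,
    A.toFun.comp (Submodule.inclusion inf_le_left) -
      B.toFun.comp (Submodule.inclusion inf_le_right)⟩

/-- The operator `-A - r` on `D(A)`. -/
def negShift (A : H →ₗ.[ℂ] H) (r : ℝ) : H →ₗ.[ℂ] H :=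
  ⟨A.domain, -A.toFun - (r : ℂ) • A.domain.subtype⟩

/-- The composition `B ∘ A` of a bounded operator with a partially defined one. -/
def compB (B : H →L[ℂ] H) (A : H →ₗ.[ℂ] H) : H →ₗ.[ℂ] H :=
  ⟨A.domain, B.toLinearMap.comp A.toFun⟩

/-- `T2` is the square `T ∘ T` of `T`, with domain `{x ∈ D(T) : T x ∈ D(T)}`. -/
def IsSquareOf (T T2 : H →ₗ.[ℂ] H) : Prop :=
  (∀ x : T2.domain, ∃ (h1 : (x : H) ∈ T.domain) (h2 : T ⟨(x : H), h1⟩ ∈ T.domain),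
      T2 x = T ⟨T ⟨(x : H), h1⟩, h2⟩) ∧
  ∀ x : H, x ∈ T2.domain ↔ ∃ h : x ∈ T.domain, T ⟨x, h⟩ ∈ T.domain

/-- The reduced minimum modulus `γ(T) = inf {‖T x‖ : x ∈ N(T)ᗮ ∩ D(T), ‖x‖ = 1}`. -/
def gammaP (T : H →ₗ.[ℂ] H) : ℝ :=
  sInf {r | ∃ x : T.domain, (x : H) ∈ (pKer T)ᗮ ∧ ‖(x : H)‖ = 1 ∧ r = ‖T x‖}

/-- The spectrum of a partially defined operator: the complement of the set of `μ` for which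
`μ - A` has an everywhere-defined bounded inverse. -/
def pSpectrum (A : H →ₗ.[ℂ] H) : Set ℂ :=
  {μ | ¬ ∃ B : H →L[ℂ] H, (∀ x : A.domain, B (μ • (x : H) - A x) = (x : H)) ∧
        ∀ y : H, ∃ h : B y ∈ A.domain, μ • B y - A ⟨B y, h⟩ = y}

/-- The numerical radius of a partially defined operator. -/
def pNumRad (A : H →ₗ.[ℂ] H) : ℝ :=
  sSup {r | ∃ x : A.domain, ‖(x : H)‖ = 1 ∧ r = ‖⟪(x : H), A x⟫‖}

/-- `B` is an everywhere-defined bounded inverse of the partially defined operator `A`. -/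
def IsBoundedInverseOf (A : H →ₗ.[ℂ] H) (B : H →L[ℂ] H) : Prop :=
  (∀ x : A.domain, B (A x) = (x : H)) ∧ ∀ y : H, ∃ h : B y ∈ A.domain, A ⟨B y, h⟩ = y

/-- The real part `(T + T*)/2` of a bounded operator. -/
def reOp (T : H →L[ℂ] H) : H →L[ℂ] H := (2 : ℂ)⁻¹ • (T + ContinuousLinearMap.adjoint T)

/-- The imaginary part `(T - T*)/(2i)` of a bounded operator. -/
def imOp (T : H →L[ℂ] H) : H →L[ℂ] H :=
  (2 * Complex.I)⁻¹ • (T - ContinuousLinearMap.adjoint T)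

/-- A bounded operator is accretive if `Re ⟨T x, x⟩ ≥ 0` for all `x`. -/
def CAccretive (T : H →L[ℂ] H) : Prop := ∀ x : H, 0 ≤ (⟪x, T x⟫).re

/-- A bounded operator is sectorial with vertex `0` and semiangle `ω` if
`W(T) ⊆ {z : |arg z| ≤ ω}`. -/
def Sectorial (T : H →L[ℂ] H) (ω : ℝ) : Prop :=
  ∀ x : H, ‖x‖ = 1 → |(⟪x, T x⟫).arg| ≤ ω

/-- The numerical radius `w(T) = sup {|⟨T x, x⟩| : ‖x‖ = 1}` of a bounded operator. -/
def numRad (T : H →L[ℂ] H) : ℝ := sSup {r | ∃ x : H, ‖x‖ = 1 ∧ r = ‖⟪x, T x⟫‖}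

section

variable {E : Type*} [NormedAddCommGroup E] [InnerProductSpace ℂ E]

theorem mem_pKer_iff {T : E →ₗ.[ℂ] E} {x : E} :
    x ∈ pKer T ↔ ∃ h : x ∈ T.domain, T ⟨x, h⟩ = 0 := by
  simp only [pKer, Submodule.mem_map, LinearMap.mem_ker, Submodule.subtype_apply]
  constructor
  · rintro ⟨z, hz, rfl⟩
    exact ⟨z.2, hz⟩
  · rintro ⟨h, hx⟩
    exact ⟨⟨x, h⟩, hx, rfl⟩

theorem mem_orthogonal_pRange_iff {T : E →ₗ.[ℂ] E} {y : E} :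
    y ∈ (pRange T)ᗮ ↔ ∀ z : T.domain, ⟪T z, y⟫ = 0 := by
  rw [Submodule.mem_orthogonal]
  constructor
  · exact fun h z => h _ ⟨z, rfl⟩
  · rintro h _ ⟨z, rfl⟩
    exact h z

/-- The kernel of an accretive operator is orthogonal to its range. -/
theorem PAccretive.pKer_le_orthogonal_pRange {T : E →ₗ.[ℂ] E} (hT : PAccretive T) :
    pKer T ≤ (pRange T)ᗮ := by
  intro x hx
  obtain ⟨hxd, hx0⟩ := mem_pKer_iff.1 hx
  rw [mem_orthogonal_pRange_iff]
  intro z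
  have key (c : ℂ) : 0 ≤ (⟪(z : E), T z⟫).re + (starRingEnd ℂ c * ⟪x, T z⟫).re := by
    have h := hT (z + c • ⟨x, hxd⟩)
    rw [T.map_add, T.map_smul, hx0] at h
    simpa [inner_add_left, inner_smul_left, mul_comm] using h
  rw [← inner_conj_symm, map_eq_zero]
  by_contra hne
  have hpos : 0 < Complex.normSq ⟪x, T z⟫ := Complex.normSq_pos.2 hne
  set a := (⟪(z : E), T z⟫).re
  have h := key (-(((a + 1) / Complex.normSq ⟪x, T z⟫ : ℝ) : ℂ) * ⟪x, T z⟫)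
  rw [map_mul, map_neg, Complex.conj_ofReal, mul_assoc, mul_comm (starRingEnd ℂ _),
    Complex.mul_conj, ← Complex.ofReal_neg, ← Complex.ofReal_mul, Complex.ofReal_re,
    neg_mul, div_mul_cancel₀ _ hpos.ne'] at h
  linarith

/-- The kernel of an m-accretive operator is the orthogonal complement of its range. -/
theorem MAccretive.pKer_eq_orthogonal_pRange {T : E →ₗ.[ℂ] E} (hT : MAccretive T) :
    pKer T = (pRange T)ᗮ := by
  refine le_antisymm hT.1.pKer_le_orthogonal_pRange fun y hy => ?_
  obtain ⟨x, hx⟩ := hT.2.2.2 1 one_pos y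
  rw [Complex.ofReal_one, one_smul] at hx
  have h := mem_orthogonal_pRange_iff.1 hy x
  rw [← hx, inner_add_right, ← inner_conj_symm (T x) (x : E)] at h
  have hre := congrArg Complex.re h
  rw [Complex.add_re, Complex.conj_re, ← RCLike.re_eq_complex_re,
    inner_self_eq_norm_sq, RCLike.re_eq_complex_re, Complex.zero_re] at hre
  have hTx : T x = 0 := by
    have := hT.1 x
    rw [← norm_eq_zero, ← sq_eq_zero_iff]
    exact le_antisymm (by linarith) (sq_nonneg _)
  rw [hTx, add_zero] at hx
  exact mem_pKer_iff.2 ⟨hx ▸ x.2, by simpa only [← hx] using hTx⟩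

namespace IsMoorePenroseInverse

variable {T Td : E →ₗ.[ℂ] E}

theorem apply_mem_orthogonal_pKer (hTd : IsMoorePenroseInverse T Td) (y : Td.domain) :
    Td y ∈ (pKer T)ᗮ := by
  obtain ⟨h1, h2, h⟩ := hTd.dtd y
  obtain ⟨_, hmem, -⟩ := hTd.proj_ker ⟨Td y, h1⟩
  rw [h] at hmem
  rwa [(Submodule.isClosed_orthogonal _).submodule_topologicalClosure_eq] at hmem

theorem orthogonal_pRange_le_domain (hTd : IsMoorePenroseInverse T Td) :
    (pRange T)ᗮ ≤ Td.domain :=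
  hTd.domain_eq ▸ le_sup_right

theorem apply_eq_zero (hTd : IsMoorePenroseInverse T Td) (y : Td.domain)
    (hy : (y : E) ∈ (pRange T)ᗮ) : Td y = 0 := by
  obtain ⟨h1, h2, h⟩ := hTd.dtd y
  obtain ⟨_, -, hproj⟩ := hTd.proj_range y
  have h0 : T ⟨Td y, h1⟩ = 0 := by
    have := Submodule.sub_mem _ hy hproj
    rw [sub_sub_cancel] at this
    exact inner_self_eq_zero.1 (mem_orthogonal_pRange_iff.1 this ⟨Td y, h1⟩)
  rw [← h, ← Td.map_zero]
  exact congrArg Td (Subtype.ext h0)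

end IsMoorePenroseInverse

end

theorem stmt_3 (T Td : H →ₗ.[ℂ] H) (hT : MAccretive T)
    (hTd : IsMoorePenroseInverse T Td) : MAccretive Td := by
  have hker := hT.pKer_eq_orthogonal_pRange
  refine ⟨fun y => ?_, hTd.dense', hTd.closed', fun μ hμ h => ?_⟩
  · obtain ⟨h1, -, hproj⟩ := hTd.proj_range y
    rw [← hker] at hproj
    have h0 := hTd.apply_mem_orthogonal_pKer y _ hproj
    rw [inner_sub_left, sub_eq_zero] at h0
    rw [h0, ← inner_conj_symm, Complex.conj_re]
    exact hT.1 ⟨Td y, h1⟩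
  · have hμ0 : (μ : ℂ) ≠ 0 := by exact_mod_cast hμ.ne'
    obtain ⟨u, hu⟩ := hT.2.2.2 μ⁻¹ (inv_pos.2 hμ) ((μ : ℂ)⁻¹ • h)
    obtain ⟨h1, -, hk⟩ := hTd.proj_ker u
    rw [hker, Submodule.triorthogonal_eq_orthogonal] at hk
    have hk' := Submodule.smul_mem _ (μ : ℂ)⁻¹ hk
    refine ⟨⟨T u, h1⟩ + ⟨_, hTd.orthogonal_pRange_le_domain hk'⟩, ?_⟩
    rw [Td.map_add, hTd.apply_eq_zero ⟨_, hTd.orthogonal_pRange_le_domain hk'⟩ hk', add_zero,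
      Submodule.coe_add, smul_add, smul_inv_smul₀ hμ0]
    have hu' := congrArg ((μ : ℂ) • ·) hu
    simp only [smul_add, Complex.ofReal_inv, smul_inv_smul₀ hμ0] at hu'
    rw [← hu']
    abel
end
end

section
/- Let T be a closed densely defined operator on a complex Hilbert space H. Then the Moore-Penrose inverse T† is m-accretive if and only if T is m-accretive. -/
open scoped ComplexInnerProductSpace
noncomputable section

variable {H : Type*} [NormedAddCommGroup H] [InnerProductSpace ℂ H] [CompleteSpace H]

set_option linter.unusedSectionVars false

section Kernel

variable {T : H →ₗ.[ℂ] H}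

theorem mem_pKer {x : H} : x ∈ pKer T ↔ ∃ h : x ∈ T.domain, T ⟨x, h⟩ = 0 := by
  simp only [pKer, Submodule.mem_map, LinearMap.mem_ker]
  constructor
  · rintro ⟨y, hy, rfl⟩
    exact ⟨y.2, hy⟩
  · rintro ⟨h, hx⟩
    exact ⟨⟨x, h⟩, hx, rfl⟩

theorem apply_mem_pRange (x : T.domain) : T x ∈ pRange T := ⟨x, rfl⟩

theorem isClosed_pKer (hT : IsClosed (T.graph : Set (H × H))) :
    IsClosed (pKer T : Set H) := by
  have : (pKer T : Set H) = (fun x : H => (x, (0 : H))) ⁻¹' (T.graph : Set (H × H)) := by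
    ext x
    simp only [SetLike.mem_coe, Set.mem_preimage, mem_pKer, LinearPMap.mem_graph_iff]
    constructor
    · rintro ⟨h, hx⟩
      exact ⟨⟨x, h⟩, rfl, hx⟩
    · rintro ⟨y, rfl, hy⟩
      exact ⟨y.2, hy⟩
  rw [this]
  exact hT.preimage (by fun_prop)

theorem orthogonal_orthogonal_pKer (hT : IsClosed (T.graph : Set (H × H))) :
    (pKer T)ᗮᗮ = pKer T := by
  rw [Submodule.orthogonal_orthogonal_eq_closure]
  exact (isClosed_pKer hT).submodule_topologicalClosure_eq

/-- The kernel of an accretive operator is orthogonal to its range. -/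
theorem PAccretive.pKer_le (hT : PAccretive T) : pKer T ≤ (pRange T)ᗮ := by
  intro n hn
  obtain ⟨h, hn0⟩ := mem_pKer.1 hn
  rw [Submodule.mem_orthogonal']
  rintro _ ⟨x, rfl⟩
  change ⟪n, T x⟫ = 0
  set a := ⟪n, T x⟫ with ha
  set r := (⟪(x : H), T x⟫).re with hr
  have key : ∀ t : ℝ, 0 ≤ -t * Complex.normSq a + t ^ 2 * Complex.normSq a * r := by
    intro t
    let c : ℂ := -t * (starRingEnd ℂ) a
    have h1 := hT (⟨n, h⟩ + c • x)
    rw [T.map_add, T.map_smul, hn0, zero_add] at h1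
    have h2 : ⟪((⟨n, h⟩ + c • x : T.domain) : H), c • T x⟫
        = c * a + (starRingEnd ℂ) c * c * ⟪(x : H), T x⟫ := by
      simp only [Submodule.coe_add, Submodule.coe_smul, inner_add_left, inner_smul_left,
        inner_smul_right, ← ha]
      ring
    rw [h2] at h1
    have h3 : c * a = ((-t * Complex.normSq a : ℝ) : ℂ) := by
      simp only [c, Complex.ofReal_mul, Complex.ofReal_neg, ← Complex.mul_conj]; ring
    have h4 : (starRingEnd ℂ) c * c = ((t ^ 2 * Complex.normSq a : ℝ) : ℂ) := by
      simp only [c, map_mul, map_neg, Complex.conj_conj, Complex.conj_ofReal,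
        Complex.ofReal_mul, Complex.ofReal_pow, ← Complex.mul_conj]; ring
    rw [h3, h4, Complex.add_re, Complex.ofReal_re, Complex.re_ofReal_mul] at h1
    exact h1
  by_contra h0
  have hpos : 0 < Complex.normSq a := Complex.normSq_pos.2 h0
  have hr0 : 0 ≤ r := hT x
  have hk := key (1 / (r + 1))
  have : -(1 / (r + 1)) * Complex.normSq a + (1 / (r + 1)) ^ 2 * Complex.normSq a * r
      = -(Complex.normSq a / (r + 1) ^ 2) := by
    field_simp; ring
  rw [this] at hk
  have : 0 < Complex.normSq a / (r + 1) ^ 2 := by positivity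
  linarith

/-- The kernel of an m-accretive operator is the orthogonal complement of its range. -/
theorem MAccretive.pKer_eq (hT : MAccretive T) : pKer T = (pRange T)ᗮ := by
  refine le_antisymm hT.1.pKer_le fun y hy => ?_
  obtain ⟨x, hx⟩ := hT.2.2.2 1 one_pos y
  rw [Complex.ofReal_one, one_smul] at hx
  have h1 : ⟪y, T x⟫ = 0 := (Submodule.mem_orthogonal' _ _).1 hy _ (apply_mem_pRange x)
  rw [← hx, inner_add_left] at h1
  have h2 := congrArg Complex.re h1
  have h3 := hT.1 x
  have h4 : (⟪T x, T x⟫).re = ‖T x‖ ^ 2 := inner_self_eq_norm_sq (𝕜 := ℂ) (T x)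
  rw [Complex.add_re, h4, Complex.zero_re] at h2
  have h5 : T x = 0 := by
    rw [← norm_eq_zero]
    nlinarith [sq_nonneg ‖T x‖]
  rw [h5, add_zero] at hx
  exact hx ▸ mem_pKer.2 ⟨x.2, h5⟩

end Kernel

theorem IsProjOnto.mem_orthogonal {M : Submodule ℂ H} {x y : H} (h : IsProjOnto Mᗮ x y) :
    y ∈ Mᗮ := by
  have := h.1
  rwa [(Submodule.isClosed_orthogonal M).submodule_topologicalClosure_eq] at this

namespace IsMoorePenroseInverse

variable {T Td : H →ₗ.[ℂ] H}

theorem apply_mem_domain (hTd : IsMoorePenroseInverse T Td) (z : Td.domain) : Td z ∈ T.domain :=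
  (hTd.dtd z).1

theorem apply_mem_domain' (hTd : IsMoorePenroseInverse T Td) (x : T.domain) : T x ∈ Td.domain :=
  (hTd.tdt x).1

theorem apply_mem_orthogonal (hTd : IsMoorePenroseInverse T Td) (z : Td.domain) :
    Td z ∈ (pKer T)ᗮ := by
  obtain ⟨h1, h2, h3⟩ := hTd.dtd z
  obtain ⟨_, h4⟩ := hTd.proj_ker ⟨Td z, h1⟩
  rw [← h3]
  exact h4.mem_orthogonal

theorem sub_mem_pKer (hTd : IsMoorePenroseInverse T Td)
    (hT : IsClosed (T.graph : Set (H × H))) (x : T.domain) :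
    (x : H) - Td ⟨T x, hTd.apply_mem_domain' x⟩ ∈ pKer T := by
  obtain ⟨_, h⟩ := hTd.proj_ker x
  have := h.2
  rwa [orthogonal_orthogonal_pKer hT] at this

theorem sub_mem_orthogonal (hTd : IsMoorePenroseInverse T Td) (z : Td.domain) :
    (z : H) - T ⟨Td z, hTd.apply_mem_domain z⟩ ∈ (pRange T)ᗮ :=
  (hTd.proj_range z).2.2

theorem pKer_eq (hTd : IsMoorePenroseInverse T Td) : pKer Td = (pRange T)ᗮ := by
  ext z
  constructor
  · intro hz
    obtain ⟨h, hz0⟩ := mem_pKer.1 hz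
    have h1 := hTd.sub_mem_orthogonal ⟨z, h⟩
    have h2 : T ⟨Td ⟨z, h⟩, hTd.apply_mem_domain ⟨z, h⟩⟩ = 0 := by
      rw [← T.map_zero]; congr 1; exact Subtype.ext hz0
    rwa [h2, sub_zero] at h1
  · intro hz
    have h : z ∈ Td.domain := by
      rw [hTd.domain_eq]; exact Submodule.mem_sup_right hz
    obtain ⟨h1, h2, h3⟩ := hTd.dtd ⟨z, h⟩
    have h4 : T ⟨Td ⟨z, h⟩, h1⟩ = 0 := by
      have h5 := Submodule.sub_mem _ hz (hTd.sub_mem_orthogonal ⟨z, h⟩)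
      rw [sub_sub_cancel] at h5
      exact inner_self_eq_zero.1
        ((Submodule.mem_orthogonal' _ _).1 h5 _ (apply_mem_pRange ⟨_, h1⟩))
    refine mem_pKer.2 ⟨h, ?_⟩
    rw [← h3, ← Td.map_zero]
    congr 1
    exact Subtype.ext h4

theorem pRange_orthogonal (hTd : IsMoorePenroseInverse T Td) (hT : IsClosed (T.graph : Set (H × H)))
    (hdense : Dense (T.domain : Set H)) : (pRange Td)ᗮ = pKer T := by
  apply le_antisymm
  · intro x hx
    rw [← orthogonal_orthogonal_pKer hT]
    let P := ((pKer T)ᗮ).starProjection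
    have hP : ∀ u ∈ T.domain, ⟪x, P u⟫ = 0 := by
      intro u hu
      have h1 : P u = Td ⟨T ⟨u, hu⟩, hTd.apply_mem_domain' ⟨u, hu⟩⟩ := by
        obtain ⟨_, h2⟩ := hTd.proj_ker ⟨u, hu⟩
        exact Submodule.eq_starProjection_of_mem_orthogonal h2.mem_orthogonal h2.2
      rw [h1]
      exact (Submodule.mem_orthogonal' _ _).1 hx _ (apply_mem_pRange _)
    have hall : (fun u => ⟪x, P u⟫) = fun _ => 0 :=
      Continuous.ext_on hdense (by fun_prop) (by fun_prop) hP
    rw [Submodule.mem_orthogonal']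
    intro u hu
    have := congrFun hall u
    rwa [Submodule.starProjection_eq_self_iff.2 hu] at this
  · intro x hx
    rw [Submodule.mem_orthogonal']
    rintro _ ⟨z, rfl⟩
    exact (Submodule.mem_orthogonal _ _).1 (hTd.apply_mem_orthogonal z) x hx

/-- Taking the Moore-Penrose inverse is an involution. -/
theorem symm (hTd : IsMoorePenroseInverse T Td)
    (hT : IsClosed (T.graph : Set (H × H))) (hdense : Dense (T.domain : Set H)) :
    IsMoorePenroseInverse Td T where
  closed' := hT
  dense' := hdense
  domain_eq := by
    rw [hTd.pRange_orthogonal hT hdense]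
    apply le_antisymm
    · intro x hx
      have h := hTd.sub_mem_pKer hT ⟨x, hx⟩
      rw [← add_sub_cancel (Td ⟨T ⟨x, hx⟩, hTd.apply_mem_domain' _⟩) x]
      exact Submodule.add_mem_sup (apply_mem_pRange _) h
    · refine sup_le ?_ fun x hx => (mem_pKer.1 hx).1
      rintro _ ⟨z, rfl⟩
      exact hTd.apply_mem_domain z
  tdt := hTd.dtd
  dtd := hTd.tdt
  proj_range x := by
    refine ⟨hTd.apply_mem_domain' x, Submodule.le_topologicalClosure _ (apply_mem_pRange _), ?_⟩
    rw [hTd.pRange_orthogonal hT hdense]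
    exact hTd.sub_mem_pKer hT x
  proj_ker z := by
    refine ⟨hTd.apply_mem_domain z, Submodule.le_topologicalClosure _ ?_, ?_⟩
    · rw [hTd.pKer_eq]
      exact Submodule.le_orthogonal_orthogonal _ (apply_mem_pRange _)
    · rw [hTd.pKer_eq]
      exact Submodule.le_orthogonal_orthogonal _ (hTd.sub_mem_orthogonal z)

theorem mAccretive (hTd : IsMoorePenroseInverse T Td) (hT : MAccretive T) : MAccretive Td := by
  have hK := hT.pKer_eq
  refine ⟨fun z => ?_, hTd.dense', hTd.closed', fun μ hμ y => ?_⟩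
  · have h1 := hTd.sub_mem_orthogonal z
    rw [← hK] at h1
    have h2 := (Submodule.mem_orthogonal _ _).1 (hTd.apply_mem_orthogonal z) _ h1
    rw [inner_sub_left, sub_eq_zero] at h2
    rw [h2, ← inner_conj_symm, Complex.conj_re]
    exact hT.1 ⟨Td z, hTd.apply_mem_domain z⟩
  · have hμ0 : (μ : ℂ) ≠ 0 := by exact_mod_cast hμ.ne'
    obtain ⟨y₂, hy₂, y₁, hy₁, rfl⟩ := (pRange T)ᗮ.exists_add_mem_mem_orthogonal y
    obtain ⟨x, hx⟩ := hT.2.2.2 μ⁻¹ (inv_pos.2 hμ) ((μ : ℂ)⁻¹ • y₁)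
    have hx' : (x : H) + (μ : ℂ) • T x = y₁ := by
      have := congrArg ((μ : ℂ) • ·) hx
      simpa [smul_smul, hμ0] using this
    have hxK : (x : H) ∈ (pKer T)ᗮ := by
      rw [hK, eq_sub_of_add_eq hx']
      exact Submodule.sub_mem _ hy₁ (Submodule.smul_mem _ _
        (Submodule.le_orthogonal_orthogonal _ (apply_mem_pRange x)))
    have hTdT : Td ⟨T x, hTd.apply_mem_domain' x⟩ = x := by
      have h1 := hTd.sub_mem_pKer hT.2.2.1 x
      have h2 := Submodule.sub_mem _ hxK (hTd.apply_mem_orthogonal ⟨T x, hTd.apply_mem_domain' x⟩)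
      exact (sub_eq_zero.1 (inner_self_eq_zero.1
        ((Submodule.mem_orthogonal _ _).1 h2 _ h1))).symm
    rw [← hTd.pKer_eq] at hy₂
    obtain ⟨h, hy0⟩ := mem_pKer.1 hy₂
    refine ⟨⟨T x, hTd.apply_mem_domain' x⟩ + (μ : ℂ)⁻¹ • ⟨y₂, h⟩, ?_⟩
    rw [Td.map_add, Td.map_smul, hy0, hTdT, ← hx']
    simp only [Submodule.coe_add, Submodule.coe_smul, smul_add, smul_smul, mul_inv_cancel₀ hμ0,
      one_smul, smul_zero, add_zero]
    abel

end IsMoorePenroseInverse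

theorem stmt_4 (T Td : H →ₗ.[ℂ] H) (hclosed : IsClosed (T.graph : Set (H × H)))
    (hdense : Dense (T.domain : Set H)) (hTd : IsMoorePenroseInverse T Td) :
    MAccretive Td ↔ MAccretive T :=
  ⟨(hTd.symm hclosed hdense).mAccretive, hTd.mAccretive⟩
end
end

section
/- Let T be a bounded accretive operator on a complex Hilbert space H, with Moore-Penrose inverse T†. If the numerical range W(T) is contained in the closed unit disk and the numerical range W(T†) is contained in the closed unit disk, then T† is bounded, R(T) is closed, and the restriction of T to R(T) is a unitary operator on R(T). -/
open scoped ComplexInnerProductSpace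
noncomputable section

variable {H : Type*} [NormedAddCommGroup H] [InnerProductSpace ℂ H] [CompleteSpace H]

theorem IsPrimitiveRoot.sum_pow_mul_conj_pow {N : ℕ} {ζ : ℂ} (hζ : IsPrimitiveRoot ζ N)
    {j k : ℕ} (hj : j < N) (hk : k < N) :
    ∑ m ∈ Finset.range N, (ζ ^ m) ^ k * (starRingEnd ℂ) ((ζ ^ m) ^ j) =
      if k = j then (N : ℂ) else 0 := by
  have hN : N ≠ 0 := by omega
  have hnorm : ‖ζ‖ = 1 := hζ.norm'_eq_one hN
  have hconj : ζ * (starRingEnd ℂ) ζ = 1 := by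
    rw [Complex.mul_conj, Complex.normSq_eq_norm_sq, hnorm]; simp
  have hterm : ∀ m, (ζ ^ m) ^ k * (starRingEnd ℂ) ((ζ ^ m) ^ j) =
      (ζ ^ k * (starRingEnd ℂ) ζ ^ j) ^ m := by
    intro m
    rw [map_pow, map_pow, mul_pow, ← pow_mul, ← pow_mul, ← pow_mul, ← pow_mul,
      mul_comm m k, mul_comm m j]
  simp_rw [hterm]
  split_ifs with h
  · subst h
    simp [← mul_pow, hconj]
  · have hne : ζ ^ k * (starRingEnd ℂ) ζ ^ j ≠ 1 := by
      intro h1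
      apply h
      apply hζ.pow_inj hk hj
      calc ζ ^ k = ζ ^ k * (ζ * (starRingEnd ℂ) ζ) ^ j := by rw [hconj]; simp
        _ = (ζ ^ k * (starRingEnd ℂ) ζ ^ j) * ζ ^ j := by rw [mul_pow]; ring
        _ = ζ ^ j := by rw [h1, one_mul]
    have hpow : (ζ ^ k * (starRingEnd ℂ) ζ ^ j) ^ N = 1 := by
      rw [mul_pow, ← pow_mul, ← pow_mul, mul_comm k, mul_comm j, pow_mul, pow_mul, ← map_pow,
        hζ.pow_eq_one]
      simp
    rw [geom_sum_eq hne, hpow]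
    simp

/-- If the numerical range of `B` lies in the closed unit disk, then the block Toeplitz form with
identity diagonal and subdiagonal `-B` has nonnegative real part. -/
theorem LinearPMap.sum_re_inner_le_sum_norm_sq {E : Type*} [NormedAddCommGroup E]
    [InnerProductSpace ℂ E] {B : E →ₗ.[ℂ] E}
    (hB : ∀ x : B.domain, ‖⟪(x : E), B x⟫‖ ≤ ‖(x : E)‖ ^ 2) (n : ℕ) (x : ℕ → B.domain) :
    ∑ k ∈ Finset.range n, (⟪(x (k + 1) : E), B (x k)⟫).re ≤
      ∑ k ∈ Finset.range (n + 1), ‖(x k : E)‖ ^ 2 := by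
  set N := n + 2
  have hζ := Complex.isPrimitiveRoot_exp N (by omega)
  set ζ := Complex.exp (2 * Real.pi * Complex.I / N)
  have hnorm : ‖ζ‖ = 1 := hζ.norm'_eq_one (by omega)
  let X : ℕ → B.domain := fun m => ∑ k ∈ Finset.range (n + 1), (ζ ^ m) ^ k • x k
  have hXcoe : ∀ m, (X m : E) = ∑ k ∈ Finset.range (n + 1), (ζ ^ m) ^ k • (x k : E) := by
    intro m; simp [X]
  have hXB : ∀ m, B (X m) = ∑ k ∈ Finset.range (n + 1), (ζ ^ m) ^ k • B (x k) := by
    intro m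
    change B.toFun (X m) = _
    rw [map_sum]
    exact Finset.sum_congr rfl fun k _ => _root_.map_smul B.toFun _ _
  have hXX : ∑ m ∈ Finset.range N, ⟪(X m : E), (X m : E)⟫ =
      N * ∑ k ∈ Finset.range (n + 1), ⟪(x k : E), (x k : E)⟫ := by
    simp_rw [hXcoe, sum_inner, inner_sum, inner_smul_left, inner_smul_right]
    rw [Finset.sum_comm, Finset.mul_sum]
    refine Finset.sum_congr rfl fun j hj => ?_
    rw [Finset.sum_comm]
    have hj' := Finset.mem_range.1 hj
    calc _ = ∑ k ∈ Finset.range (n + 1), (if k = j then (N : ℂ) else 0) *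
            ⟪(x j : E), (x k : E)⟫ := by
          refine Finset.sum_congr rfl fun k hk => ?_
          have hk' := Finset.mem_range.1 hk
          rw [← hζ.sum_pow_mul_conj_pow (j := j) (k := k) (by omega) (by omega), Finset.sum_mul]
          exact Finset.sum_congr rfl fun m _ => by ring
      _ = _ := by simp [hj']
  have hXBX : ∑ m ∈ Finset.range N, ζ ^ m * ⟪(X m : E), B (X m)⟫ =
      N * ∑ k ∈ Finset.range n, ⟪(x (k + 1) : E), B (x k)⟫ := by
    simp_rw [hXB, hXcoe, sum_inner, inner_sum, inner_smul_left, inner_smul_right, Finset.mul_sum]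
    rw [Finset.sum_comm]
    calc _ = ∑ j ∈ Finset.range (n + 1), ∑ k ∈ Finset.range (n + 1),
            (if k + 1 = j then (N : ℂ) else 0) * ⟪(x j : E), B (x k)⟫ := by
          refine Finset.sum_congr rfl fun j hj => ?_
          rw [Finset.sum_comm]
          refine Finset.sum_congr rfl fun k hk => ?_
          have hj' := Finset.mem_range.1 hj
          have hk' := Finset.mem_range.1 hk
          rw [← hζ.sum_pow_mul_conj_pow (j := j) (k := k + 1) (by omega) (by omega),
            Finset.sum_mul]
          exact Finset.sum_congr rfl fun m _ => by ring
      _ = _ := by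
          rw [Finset.sum_comm, Finset.sum_range_succ]
          simp only [ite_mul, zero_mul, Finset.sum_ite_eq, Finset.mem_range]
          rw [if_neg (by omega), add_zero]
          exact Finset.sum_congr rfl fun k hk => if_pos (by have := Finset.mem_range.1 hk; omega)
  have hle : ∀ m, (ζ ^ m * ⟪(X m : E), B (X m)⟫).re ≤ (⟪(X m : E), (X m : E)⟫).re := by
    intro m
    calc _ ≤ ‖ζ ^ m * ⟪(X m : E), B (X m)⟫‖ := Complex.re_le_norm _
      _ = ‖⟪(X m : E), B (X m)⟫‖ := by rw [norm_mul, norm_pow, hnorm, one_pow, one_mul]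
      _ ≤ ‖(X m : E)‖ ^ 2 := hB _
      _ = _ := by rw [inner_self_eq_norm_sq_to_K]; norm_cast
  have hsum := Finset.sum_le_sum fun m (_ : m ∈ Finset.range N) => hle m
  rw [← Complex.re_sum, ← Complex.re_sum, hXX, hXBX, ← Complex.ofReal_natCast,
    Complex.re_ofReal_mul, Complex.re_ofReal_mul, Complex.re_sum, Complex.re_sum] at hsum
  have hNpos : (0 : ℝ) < N := by positivity
  refine (le_of_mul_le_mul_left hsum hNpos).trans_eq ?_
  refine Finset.sum_congr rfl fun k _ => ?_
  rw [inner_self_eq_norm_sq_to_K]; norm_cast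

theorem LinearPMap.norm_inner_le_norm_sq_of_unit {E : Type*} [NormedAddCommGroup E]
    [InnerProductSpace ℂ E] {B : E →ₗ.[ℂ] E}
    (hB : ∀ x : B.domain, ‖(x : E)‖ = 1 → ‖⟪(x : E), B x⟫‖ ≤ 1) (x : B.domain) :
    ‖⟪(x : E), B x⟫‖ ≤ ‖(x : E)‖ ^ 2 := by
  by_cases hx : (x : E) = 0
  · simp [hx]
  have hpos : 0 < ‖(x : E)‖ := norm_pos_iff.2 hx
  have h := hB (((‖(x : E)‖⁻¹ : ℝ) : ℂ) • x) (by
    rw [Submodule.coe_smul, norm_smul]; simp [hpos.ne'])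
  rw [LinearPMap.map_smul, Submodule.coe_smul, inner_smul_left, inner_smul_right, norm_mul,
    norm_mul] at h
  simp only [Complex.conj_ofReal, Complex.norm_real, norm_inv, norm_norm] at h
  field_simp at h
  exact h

/-- A densely defined operator with numerical range in the closed unit disk has norm at most 2. -/
theorem LinearPMap.norm_le_two_mul_norm {E : Type*} [NormedAddCommGroup E]
    [InnerProductSpace ℂ E] {B : E →ₗ.[ℂ] E} (hd : Dense (B.domain : Set E))
    (hB : ∀ x : B.domain, ‖⟪(x : E), B x⟫‖ ≤ ‖(x : E)‖ ^ 2) (x : B.domain) :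
    ‖B x‖ ≤ 2 * ‖(x : E)‖ := by
  have hdom : ∀ y ∈ (B.domain : Set E), (⟪y, B x⟫).re ≤ ‖(x : E)‖ ^ 2 + ‖y‖ ^ 2 := by
    intro y hy
    have h := LinearPMap.sum_re_inner_le_sum_norm_sq hB 1
      (fun k => if k = 0 then x else ⟨y, hy⟩)
    simpa [Finset.sum_range_succ] using h
  have hall : ∀ y : E, (⟪y, B x⟫).re ≤ ‖(x : E)‖ ^ 2 + ‖y‖ ^ 2 := by
    have hcl : _root_.IsClosed {y : E | (⟪y, B x⟫).re ≤ ‖(x : E)‖ ^ 2 + ‖y‖ ^ 2} :=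
      isClosed_le (by fun_prop) (by fun_prop)
    intro y
    exact hcl.closure_subset_iff.2 hdom (hd y)
  have h := hall ((((1 / 2 : ℝ)) : ℂ) • B x)
  rw [inner_smul_left, inner_self_eq_norm_sq_to_K, norm_smul, Complex.conj_ofReal,
    Complex.re_ofReal_mul, Complex.norm_real] at h
  norm_num [← Complex.ofReal_pow] at h
  refine abs_le_of_sq_le_sq' ?_ (by positivity) |>.2
  nlinarith

/-- Testing both quadratic forms on a tent centred at `M + 1`, and the first one on perturbations
of it at the peak, compares `a (M + 1)` with `a (M + 2)`. -/
theorem sq_sub_le_of_sum_mul_succ_le {a : ℕ → ℝ} (M : ℕ)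
    (h₁ : ∀ (n : ℕ) (c : ℕ → ℝ), ∑ k ∈ Finset.range n, c (k + 1) * c k * a (k + 1) ≤
      ∑ k ∈ Finset.range (n + 1), c k ^ 2 * a k)
    (h₂ : ∀ (n : ℕ) (c : ℕ → ℝ), ∑ k ∈ Finset.range n, c (k + 1) * c k * a k ≤
      ∑ k ∈ Finset.range (n + 1), c k ^ 2 * a k) :
    ((M + 2) * a (M + 1) - M * a (M + 2)) ^ 2 ≤ 8 * (M + 1) * a (M + 1) ^ 2 := by
  let φ : ℕ → ℝ := fun k => (M + 1) - |(k : ℝ) - (M + 1)|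
  let d : ℕ → ℝ := fun k => if k = M + 1 then 1 else 0
  set n := 2 * M + 2 with hn
  have hφ0 : φ 0 = 0 := by
    simp only [φ, Nat.cast_zero, zero_sub, abs_neg]
    rw [abs_of_nonneg (by positivity), sub_self]
  have hφn : φ n = 0 := by
    simp only [φ, hn]
    push_cast
    rw [abs_of_nonneg (by linarith [(Nat.cast_nonneg M : (0 : ℝ) ≤ M)])]
    ring
  have hφM : φ M = M := by simp [φ]
  have hφM1 : φ (M + 1) = M + 1 := by simp [φ]
  have hφM2 : φ (M + 2) = M := by
    simp only [φ]
    push_cast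
    rw [abs_of_nonneg (by linarith)]
    ring
  have hsecond : ∀ k, 2 * φ (k + 1) - φ k - φ (k + 2) = if k + 1 = M + 1 then 2 else 0 := by
    intro k
    rcases lt_trichotomy k M with h | h | h
    · have h' : (k : ℝ) + 1 ≤ M := by exact_mod_cast h
      rw [if_neg (by omega)]
      simp only [φ]
      push_cast
      rw [abs_of_nonpos (by linarith), abs_of_nonpos (by linarith), abs_of_nonpos (by linarith)]
      ring
    · subst h
      rw [if_pos rfl, hφM, hφM1, hφM2]
      ring
    · have h' : (M : ℝ) + 1 ≤ k := by exact_mod_cast h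
      rw [if_neg (by omega)]
      simp only [φ]
      push_cast
      rw [abs_of_nonneg (by linarith), abs_of_nonneg (by linarith), abs_of_nonneg (by linarith)]
      ring
  have htent : ∑ k ∈ Finset.range (n + 1), φ k ^ 2 * a k -
      ∑ k ∈ Finset.range n, φ (k + 1) * φ k * a (k + 1) ≤ 2 * (M + 1) * a (M + 1) := by
    have hsq : ∑ k ∈ Finset.range (n + 1), φ k ^ 2 * a k =
        ∑ k ∈ Finset.range n, φ (k + 1) ^ 2 * a (k + 1) := by
      rw [Finset.sum_range_succ', hφ0]; simp
    have hS : ∑ k ∈ Finset.range n, φ (k + 1) * φ k * a k =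
        ∑ k ∈ Finset.range n, φ (k + 2) * φ (k + 1) * a (k + 1) := by
      have := Finset.sum_range_succ' (fun k => φ (k + 1) * φ k * a k) n
      rw [Finset.sum_range_succ, hφn, hφ0] at this
      simpa using this
    have h := h₂ n φ
    have hpeak : ∑ k ∈ Finset.range n,
        φ (k + 1) * a (k + 1) * (2 * φ (k + 1) - φ k - φ (k + 2)) =
        2 * (M + 1) * a (M + 1) := by
      simp_rw [hsecond, add_left_inj, mul_ite, mul_zero]
      rw [Finset.sum_ite_eq', if_pos (by rw [Finset.mem_range]; omega), hφM1]
      ring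
    have hexp : ∑ k ∈ Finset.range n,
        φ (k + 1) * a (k + 1) * (2 * φ (k + 1) - φ k - φ (k + 2)) =
        2 * ∑ k ∈ Finset.range n, φ (k + 1) ^ 2 * a (k + 1) -
        ∑ k ∈ Finset.range n, φ (k + 1) * φ k * a (k + 1) -
        ∑ k ∈ Finset.range n, φ (k + 2) * φ (k + 1) * a (k + 1) := by
      rw [Finset.mul_sum, ← Finset.sum_sub_distrib, ← Finset.sum_sub_distrib]
      exact Finset.sum_congr rfl fun k _ => by ring
    linarith
  have hquad : ∀ t : ℝ, 0 ≤ a (M + 1) * (t * t) +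
      ((M + 2) * a (M + 1) - M * a (M + 2)) * t + 2 * (M + 1) * a (M + 1) := by
    intro t
    have h := h₁ n fun k => φ k + t * d k
    have hd₁ : ∑ k ∈ Finset.range (n + 1), (φ k + t * d k) ^ 2 * a k =
        ∑ k ∈ Finset.range (n + 1), φ k ^ 2 * a k +
          (2 * t * (M + 1) + t ^ 2) * a (M + 1) := by
      have : ∀ k, (φ k + t * d k) ^ 2 * a k = φ k ^ 2 * a k +
          if k = M + 1 then (2 * t * φ k + t ^ 2) * a k else 0 := by
        intro k
        simp only [d]
        split_ifs <;> ring
      simp_rw [this]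
      rw [Finset.sum_add_distrib, Finset.sum_ite_eq',
        if_pos (by rw [Finset.mem_range]; omega), hφM1]
    have hd₂ : ∑ k ∈ Finset.range n,
        (φ (k + 1) + t * d (k + 1)) * (φ k + t * d k) * a (k + 1) =
        ∑ k ∈ Finset.range n, φ (k + 1) * φ k * a (k + 1) +
          t * M * a (M + 1) + t * M * a (M + 2) := by
      have : ∀ k, (φ (k + 1) + t * d (k + 1)) * (φ k + t * d k) * a (k + 1) =
          φ (k + 1) * φ k * a (k + 1) + (if k = M then t * φ k * a (k + 1) else 0) +
          if k = M + 1 then t * φ (k + 1) * a (k + 1) else 0 := by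
        intro k
        simp only [d, add_left_inj]
        split_ifs
        · omega
        all_goals ring
      simp_rw [this]
      rw [Finset.sum_add_distrib, Finset.sum_add_distrib, Finset.sum_ite_eq', Finset.sum_ite_eq',
        hφM, hφM2]
      by_cases hM : M = 0
      · subst hM; simp [hn]
      · rw [if_pos (by rw [Finset.mem_range]; omega), if_pos (by rw [Finset.mem_range]; omega)]
    rw [hd₁, hd₂] at h
    linarith
  have hdisc := discrim_le_zero hquad
  rw [discrim] at hdisc
  linarith

theorem eq_of_forall_nat_sq_sub_le {a b : ℝ}
    (h : ∀ M : ℕ, ((M + 2) * a - M * b) ^ 2 ≤ 8 * (M + 1) * a ^ 2) : a = b := by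
  by_contra hne
  have hpos : 0 < (a - b) ^ 2 := by
    have := sub_ne_zero.2 hne
    positivity
  obtain ⟨M, hM⟩ := exists_nat_gt ((12 * a ^ 2 + 4 * |a * (a - b)|) / (a - b) ^ 2)
  rw [div_lt_iff₀ hpos] at hM
  have hMpos : (0 : ℝ) < M := by
    by_contra h0
    have : (M : ℝ) * (a - b) ^ 2 ≤ 0 := mul_nonpos_of_nonpos_of_nonneg (not_lt.1 h0) hpos.le
    have : 0 ≤ 12 * a ^ 2 + 4 * |a * (a - b)| := by positivity
    linarith
  have hM1 : (1 : ℝ) ≤ M := by exact_mod_cast (by exact_mod_cast hMpos : 0 < M)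
  have habs := neg_abs_le (a * (a - b))
  nlinarith [h M, mul_lt_mul_of_pos_left hM hMpos, mul_le_mul_of_nonneg_left habs hMpos.le,
    mul_nonneg (sub_nonneg.2 hM1) (sq_nonneg a)]

/-- If `A` maps a set `R` onto itself, `B` inverts `A` on `R`, and both numerical ranges lie in the
closed unit disk, then `A` preserves norms on `R`. -/
theorem norm_map_eq_norm_of_numericalRange {E : Type*} [NormedAddCommGroup E]
    [InnerProductSpace ℂ E] {A B : E →ₗ.[ℂ] E}
    (hA : ∀ x : A.domain, ‖⟪(x : E), A x⟫‖ ≤ ‖(x : E)‖ ^ 2)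
    (hB : ∀ x : B.domain, ‖⟪(x : E), B x⟫‖ ≤ ‖(x : E)‖ ^ 2)
    {R : Set E} {f : E → E} (hf : Set.MapsTo f R R) (hsurj : Set.SurjOn f R R)
    (hfA : ∀ x ∈ R, ∃ h : x ∈ A.domain, A ⟨x, h⟩ = f x)
    (hfB : ∀ x ∈ R, x ∈ B.domain ∧ ∃ h : f x ∈ B.domain, B ⟨f x, h⟩ = x)
    {x : E} (hx : x ∈ R) : ‖f x‖ = ‖x‖ := by
  have key : ‖x‖ ^ 2 = ‖f x‖ ^ 2 := by
    refine eq_of_forall_nat_sq_sub_le fun M => ?_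
    obtain ⟨w, hw, hwx⟩ := hsurj.iterate (M + 1) hx
    have hz : ∀ k, f^[k] w ∈ R := fun k => hf.iterate k hw
    have hre : ∀ (r s : ℝ) (v : E),
        (⟪(r : ℂ) • v, (s : ℂ) • v⟫).re = r * s * ‖v‖ ^ 2 := by
      intro r s v
      rw [inner_smul_left, inner_smul_right, inner_self_eq_norm_sq_to_K, Complex.conj_ofReal,
        ← mul_assoc, ← Complex.ofReal_mul, Complex.re_ofReal_mul]
      norm_cast
    have hsq : ∀ (r : ℝ) (v : E), ‖(r : ℂ) • v‖ ^ 2 = r ^ 2 * ‖v‖ ^ 2 := by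
      intro r v
      rw [norm_smul, Complex.norm_real, mul_pow, Real.norm_eq_abs, sq_abs]
    have h := sq_sub_le_of_sum_mul_succ_le (a := fun k => ‖f^[k] w‖ ^ 2) M ?_ ?_
    · rwa [hwx, Function.iterate_succ_apply', hwx] at h
    · intro n c
      choose hmem hval using hfA
      have h := LinearPMap.sum_re_inner_le_sum_norm_sq hA n
        fun k => (c k : ℂ) • ⟨f^[k] w, hmem _ (hz k)⟩
      have hval' : ∀ k, A ⟨f^[k] w, hmem _ (hz k)⟩ = f^[k + 1] w := fun k =>
        (hval _ (hz k)).trans (Function.iterate_succ_apply' f k w).symm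
      simp only [Submodule.coe_smul, LinearPMap.map_smul, hval', hre, hsq] at h
      exact h
    · intro n c
      have hmem : ∀ k, f^[k] w ∈ B.domain := fun k => (hfB _ (hz k)).1
      have hval : ∀ k, B ⟨f^[k + 1] w, hmem (k + 1)⟩ = f^[k] w := by
        intro k
        obtain ⟨-, h, hBk⟩ := hfB _ (hz k)
        simp only [Function.iterate_succ_apply']
        exact hBk
      have h := LinearPMap.sum_re_inner_le_sum_norm_sq hB n
        fun k => (c (n - k) : ℂ) • ⟨f^[n - k] w, hmem (n - k)⟩
      rw [← Finset.sum_range_reflect (fun k => c (k + 1) * c k * ‖f^[k] w‖ ^ 2),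
        ← Finset.sum_range_reflect (fun k => c k ^ 2 * ‖f^[k] w‖ ^ 2)]
      refine le_of_eq_of_le ?_ (h.trans_eq ?_)
      · refine Finset.sum_congr rfl fun k hk => ?_
        obtain ⟨m, rfl⟩ : ∃ m, n = k + m + 1 :=
          ⟨n - k - 1, by have := Finset.mem_range.1 hk; omega⟩
        have e₁ : k + m + 1 - k = m + 1 := by omega
        have e₂ : k + m + 1 - (k + 1) = m := by omega
        have e₃ : k + m + 1 - 1 - k = m := by omega
        simp only [e₁, e₂, e₃, Submodule.coe_smul, LinearPMap.map_smul, hval, hre]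
        ring
      · refine Finset.sum_congr rfl fun k _ => ?_
        simp only [Submodule.coe_smul, hsq, Nat.add_sub_cancel]
  exact ((sq_eq_sq₀ (norm_nonneg _) (norm_nonneg _)).1 key).symm

/-- The kernel of an accretive operator is the orthogonal complement of its range. -/
theorem CAccretive.ker_eq_orthogonal_range {E : Type*} [NormedAddCommGroup E]
    [InnerProductSpace ℂ E] {T : E →L[ℂ] E} (hT : CAccretive T) :
    LinearMap.ker T.toLinearMap = (LinearMap.range T.toLinearMap)ᗮ := by
  have hsmall : ∀ p q : ℝ, (∀ t : ℝ, 0 ≤ q * (t * t) + p * t) → p = 0 := by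
    intro p q h
    have := discrim_le_zero (a := q) (b := p) (c := 0) fun t => by simpa using h t
    rw [discrim] at this
    nlinarith [sq_nonneg p]
  ext x
  rw [LinearMap.mem_ker, Submodule.mem_orthogonal']
  constructor
  · rintro hx _ ⟨y, rfl⟩
    change T x = 0 at hx
    change ⟪x, T y⟫ = 0
    have h := hsmall (Complex.normSq ⟪x, T y⟫) ((⟪y, T y⟫).re) ?_
    · exact Complex.normSq_eq_zero.1 h
    intro t
    have := hT ((t : ℂ) • y + ⟪x, T y⟫ • x)
    simp only [map_add, map_smul, hx, smul_zero, add_zero, inner_add_left, inner_smul_left,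
      inner_smul_right, Complex.conj_ofReal] at this
    rw [← Complex.normSq_eq_conj_mul_self, Complex.re_ofReal_mul, Complex.add_re,
      Complex.re_ofReal_mul, Complex.ofReal_re] at this
    linarith
  · intro hx
    have hx' : ∀ y, ⟪x, T y⟫ = 0 := fun y => hx _ ⟨y, rfl⟩
    change T x = 0
    have h := hsmall (‖T x‖ ^ 2) ((⟪T x, T (T x)⟫).re) ?_
    · simpa using h
    intro t
    have := hT (x + (t : ℂ) • T x)
    simp only [map_add, map_smul, inner_add_left, inner_add_right, inner_smul_left,
      inner_smul_right, hx', Complex.conj_ofReal, inner_self_eq_norm_sq_to_K] at this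
    norm_num [← Complex.ofReal_pow] at this
    linarith

theorem stmt_7 (T : H →L[ℂ] H) (hacc : CAccretive T) (Td : H →ₗ.[ℂ] H)
    (hTd : IsMoorePenroseInverse (clmToPMap T) Td)
    (hWT : ∀ x : H, ‖x‖ = 1 → ‖⟪x, T x⟫‖ ≤ 1)
    (hWTd : ∀ x : Td.domain, ‖(x : H)‖ = 1 → ‖⟪(x : H), Td x⟫‖ ≤ 1) :
    BoundedPMap Td ∧
    IsClosed ((LinearMap.range T.toLinearMap : Set H)) ∧
    (∀ x ∈ LinearMap.range T.toLinearMap, T x ∈ LinearMap.range T.toLinearMap) ∧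
    (∀ x ∈ LinearMap.range T.toLinearMap, ‖T x‖ = ‖x‖) ∧
    (∀ y ∈ LinearMap.range T.toLinearMap, ∃ x ∈ LinearMap.range T.toLinearMap, T x = y) := by
  have hA : ∀ x : (clmToPMap T).domain, ‖⟪(x : H), clmToPMap T x⟫‖ ≤ ‖(x : H)‖ ^ 2 :=
    LinearPMap.norm_inner_le_norm_sq_of_unit fun x hx => hWT x hx
  have hB := LinearPMap.norm_inner_le_norm_sq_of_unit hWTd
  have hbound := LinearPMap.norm_le_two_mul_norm hTd.dense' hB
  set R := LinearMap.range T.toLinearMap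
  set K := LinearMap.ker T.toLinearMap
  have hKR : K = Rᗮ := hacc.ker_eq_orthogonal_range
  have hpKer : pKer (clmToPMap T) = K := by
    ext x
    simp only [pKer, Submodule.mem_map, LinearMap.mem_ker]
    exact ⟨fun ⟨y, hy, hyx⟩ => hyx ▸ hy, fun hx => ⟨⟨x, trivial⟩, hx, rfl⟩⟩
  have hinv : ∀ x ∈ Kᗮ, ∃ h : T x ∈ Td.domain, Td ⟨T x, h⟩ = x := by
    intro x hx
    obtain ⟨h, hmem, hsub⟩ := hTd.proj_ker ⟨x, trivial⟩
    rw [hpKer] at hmem hsub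
    rw [(Submodule.isClosed_orthogonal K).submodule_topologicalClosure_eq] at hmem
    refine ⟨h, ?_⟩
    have h0 := (Submodule.orthogonal_disjoint Kᗮ).le_bot ⟨Kᗮ.sub_mem hx hmem, hsub⟩
    exact (sub_eq_zero.1 ((Submodule.mem_bot ℂ).1 h0)).symm
  have hKclosed : IsClosed (K : Set H) := T.isClosed_ker
  have hrange : ∀ y ∈ R, ∃ x ∈ Kᗮ, T x = y := by
    rintro _ ⟨x, rfl⟩
    have : CompleteSpace K := hKclosed.completeSpace_coe
    obtain ⟨k, hk, z, hz, rfl⟩ := K.exists_add_mem_mem_orthogonal x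
    refine ⟨z, hz, ?_⟩
    have hk' : T k = 0 := hk
    simp [hk']
  have hclosed : IsClosed (R : Set H) := by
    have hanti : AntilipschitzWith 2 (T ∘L Kᗮ.subtypeL) := by
      refine AddMonoidHomClass.antilipschitz_of_bound _ fun x => ?_
      obtain ⟨h, hx⟩ := hinv x x.2
      have := hbound ⟨T x, h⟩
      rw [hx] at this
      simpa using this
    have himg : (R : Set H) = Set.range (T ∘L Kᗮ.subtypeL) := by
      ext y
      constructor
      · intro hy
        obtain ⟨x, hx, hxy⟩ := hrange y hy
        exact ⟨⟨x, hx⟩, hxy⟩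
      · rintro ⟨x, rfl⟩
        exact ⟨x, rfl⟩
    rw [himg]
    exact hanti.isClosed_range (T ∘L Kᗮ.subtypeL).uniformContinuous
  have hKo : Kᗮ = R := by
    rw [hKR, Submodule.orthogonal_orthogonal_eq_closure,
      hclosed.submodule_topologicalClosure_eq]
  rw [hKo] at hinv hrange
  have hmaps : ∀ x ∈ R, T x ∈ R := fun x _ => ⟨x, rfl⟩
  have hRdom : ∀ x ∈ R, x ∈ Td.domain := by
    intro x hx
    obtain ⟨z, hz, rfl⟩ := hrange x hx
    exact (hinv z hz).1
  refine ⟨⟨2, hbound⟩, hclosed, hmaps, fun x hx => ?_, hrange⟩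
  exact norm_map_eq_norm_of_numericalRange (R := R) (f := T) hA hB hmaps hrange
    (fun x _ => ⟨trivial, rfl⟩) (fun x hx => ⟨hRdom x hx, hinv x hx⟩) hx
end
end

section
/- Let T be an m-accretive operator on a complex Hilbert space H with closed range and let S be a bounded accretive operator on H such that R(S) ⊆ R(T) and ‖T†S‖ < 1. Then ‖(T + S)† − T†‖ ≤ ‖S‖ ‖T†‖² / (1 − ‖T†S‖). -/
open scoped ComplexInnerProductSpace
noncomputable section

variable {H : Type*} [NormedAddCommGroup H] [InnerProductSpace ℂ H] [CompleteSpace H]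

/-- A real quadratic polynomial without constant term that is nonnegative everywhere has vanishing
linear coefficient. -/
lemma eq_zero_of_forall_mul_add_sq_nonneg {a b : ℝ} (h : ∀ t : ℝ, 0 ≤ t * a + t ^ 2 * b) :
    a = 0 := by
  have hb : 0 < |b| + 1 := by positivity
  have h' := h (-a / (|b| + 1))
  have e : -a / (|b| + 1) * a + (-a / (|b| + 1)) ^ 2 * b
      = -(a ^ 2 * (|b| + 1 - b)) / (|b| + 1) ^ 2 := by
    field_simp
    ring
  rw [e, le_div_iff₀ (by positivity)] at h'
  have := le_abs_self b
  nlinarith [sq_nonneg a, mul_nonneg (sq_nonneg a) (sub_nonneg.2 this)]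

omit [CompleteSpace H] in
/-- The kernel of an accretive operator is orthogonal to its range. -/
lemma PAccretive.re_inner_eq_zero {T : H →ₗ.[ℂ] H} (hT : PAccretive T) {x : T.domain}
    (hx : T x = 0) (u : T.domain) : (⟪(x : H), T u⟫).re = 0 := by
  refine eq_zero_of_forall_mul_add_sq_nonneg (b := (⟪(u : H), T u⟫).re) fun t ↦ ?_
  have h := hT (x + (t : ℂ) • u)
  simp only [T.map_add, T.map_smul, hx, zero_add, Submodule.coe_add, Submodule.coe_smul,
    inner_add_left, inner_smul_left, inner_smul_right, Complex.conj_ofReal, Complex.add_re,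
    Complex.re_ofReal_mul] at h
  linarith

omit [CompleteSpace H] in
/-- A vector whose inner products with the range of a bounded accretive operator have zero real
part is annihilated by that operator. -/
lemma CAccretive.apply_eq_zero {S : H →L[ℂ] H} (hS : CAccretive S) {x : H}
    (hx : ∀ u, (⟪x, S u⟫).re = 0) : S x = 0 := by
  have key : (⟪S x, S x⟫).re = 0 := by
    refine eq_zero_of_forall_mul_add_sq_nonneg (b := (⟪S x, S (S x)⟫).re) fun t ↦ ?_
    have h := hS (x + (t : ℂ) • S x)
    simp only [map_add, map_smul, inner_add_left, inner_add_right, inner_smul_left,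
      inner_smul_right, Complex.conj_ofReal, Complex.add_re, Complex.re_ofReal_mul, hx] at h
    linarith
  exact inner_self_eq_zero.1 (Complex.ext key (inner_self_im (𝕜 := ℂ) (S x)))

omit [CompleteSpace H] in
lemma IsProjOnto.unique {M : Submodule ℂ H} {x y z : H} (hy : IsProjOnto M x y)
    (hz : IsProjOnto M x z) : y = z := by
  have h1 : y - z ∈ M.topologicalClosure := sub_mem hy.1 hz.1
  have h2 : y - z ∈ M.topologicalClosureᗮ := by
    rw [Submodule.orthogonal_closure]
    simpa using sub_mem hz.2 hy.2
  exact sub_eq_zero.1 (inner_self_eq_zero.1 (h2 _ h1))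

omit [CompleteSpace H] in
/-- An element of a subspace is its own projection onto the closure. -/
lemma isProjOnto_self {M : Submodule ℂ H} {x : H} (hx : x ∈ M) : IsProjOnto M x x :=
  ⟨M.le_topologicalClosure hx, by simp⟩

/-- A perturbation with range in `R(T)` and `‖T† S‖ < 1` does not change the range. -/
lemma pRange_addB {T : H →ₗ.[ℂ] H} {S Td : H →L[ℂ] H}
    (hTd : IsMoorePenroseInverse T (clmToPMap Td))
    (hRS : LinearMap.range S.toLinearMap ≤ pRange T) (hn : ‖Td * S‖ < 1) :
    pRange (addB T S) = pRange T := by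
  apply le_antisymm
  · rintro _ ⟨x, rfl⟩
    exact add_mem (LinearMap.mem_range_self T.toFun x) (hRS ⟨x, rfl⟩)
  · rintro _ ⟨x, rfl⟩
    obtain ⟨U, hU⟩ := isUnit_one_sub_of_norm_lt_one (x := -(Td * S)) (by rwa [norm_neg])
    set z : H := (↑U⁻¹ : H →L[ℂ] H) x
    have hz : z + Td (S z) = x := by
      have := congrArg (fun A : H →L[ℂ] H ↦ A x) U.mul_inv
      rw [hU] at this
      simpa using this
    obtain ⟨hd, hp⟩ := hTd.proj_range ⟨S z, trivial⟩
    have hSz : T ⟨Td (S z), hd⟩ = S z := hp.unique (isProjOnto_self (hRS ⟨z, rfl⟩))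
    have hzd : z ∈ T.domain := by
      rw [eq_sub_of_add_eq hz]
      exact sub_mem x.2 hd
    refine ⟨⟨z, hzd⟩, ?_⟩
    change T ⟨z, hzd⟩ + S z = T x
    rw [← hSz, ← T.map_add]
    congr 1
    exact Subtype.ext hz

omit [CompleteSpace H] in
/-- The kernel of an accretive operator is contained in that of an accretive perturbation whose
bounded summand has range in `R(T)`. -/
lemma pKer_le_pKer_addB {T : H →ₗ.[ℂ] H} {S : H →L[ℂ] H} (hT : PAccretive T)
    (hS : CAccretive S) (hRS : LinearMap.range S.toLinearMap ≤ pRange T) :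
    pKer T ≤ pKer (addB T S) := by
  rintro _ ⟨x, hx, rfl⟩
  have hx' : T x = 0 := hx
  refine ⟨x, ?_, rfl⟩
  have hSx : S (x : H) = 0 := hS.apply_eq_zero fun u ↦ by
    obtain ⟨v, hv⟩ := hRS ⟨u, rfl⟩
    have h := hT.re_inner_eq_zero hx' v
    rwa [show T v = S u from hv] at h
  change T x + S x = 0
  rw [hx', hSx, add_zero]

/-- The resolvent-type identity `(T + S)† + T† S (T + S)† = T†`. -/
lemma moorePenrose_addB_identity {T : H →ₗ.[ℂ] H} {S Td X : H →L[ℂ] H} (hT : PAccretive T)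
    (hS : CAccretive S) (hTd : IsMoorePenroseInverse T (clmToPMap Td))
    (hRS : LinearMap.range S.toLinearMap ≤ pRange T) (hn : ‖Td * S‖ < 1)
    (hX : IsMoorePenroseInverse (addB T S) (clmToPMap X)) :
    X + Td * S * X = Td := by
  ext y
  obtain ⟨h1, hp⟩ := hX.proj_range ⟨y, trivial⟩
  obtain ⟨h2, hq⟩ := hTd.proj_range ⟨y, trivial⟩
  rw [pRange_addB hTd hRS hn] at hp
  have hTX : T ⟨X y, h1⟩ + S (X y) = T ⟨Td y, h2⟩ := hp.unique hq
  have hTdT : Td (T ⟨Td y, h2⟩) = Td y := by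
    obtain ⟨_, _, h⟩ := hTd.dtd ⟨y, trivial⟩
    exact h
  have hperp : X y ∈ (pKer T)ᗮ := by
    refine Submodule.orthogonal_le (pKer_le_pKer_addB hT hS hRS) ?_
    obtain ⟨_, h⟩ := hX.proj_ker ⟨X y, h1⟩
    obtain ⟨_, _, h'⟩ := hX.dtd ⟨y, trivial⟩
    rw [← (Submodule.isClosed_orthogonal (pKer (addB T S))).submodule_topologicalClosure_eq]
    have h'' : X (addB T S ⟨X y, h1⟩) = X y := h'
    rw [← h'']
    exact h.1
  have hproj : Td (T ⟨X y, h1⟩) = X y := by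
    obtain ⟨_, h⟩ := hTd.proj_ker ⟨X y, h1⟩
    exact h.unique (isProjOnto_self hperp)
  have := congrArg Td hTX
  rw [map_add, hproj, hTdT] at this
  exact this

theorem stmt_10 (T : H →ₗ.[ℂ] H) (S Td : H →L[ℂ] H)
    (hT : MAccretive T) (hcl : IsClosed ((pRange T : Set H)))
    (hS : CAccretive S) (hTd : IsMoorePenroseInverse T (clmToPMap Td))
    (hRS : LinearMap.range S.toLinearMap ≤ pRange T) (hn : ‖Td * S‖ < 1) :
    ∀ TSd : H →L[ℂ] H, IsMoorePenroseInverse (addB T S) (clmToPMap TSd) →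
      ‖TSd - Td‖ ≤ ‖S‖ * ‖Td‖ ^ 2 / (1 - ‖Td * S‖) := by
  intro X hX
  have hid := moorePenrose_addB_identity hT.1 hS hTd hRS hn hX
  have hdiff : X - Td = -(Td * S * X) := by
    conv_lhs => rw [← hid]
    abel
  have hXle : ‖X‖ * (1 - ‖Td * S‖) ≤ ‖Td‖ := by
    have h1 : ‖X‖ ≤ ‖Td‖ + ‖Td * S * X‖ := by
      conv_lhs => rw [eq_sub_of_add_eq hid]
      exact norm_sub_le _ _
    have h2 := norm_mul_le (Td * S) X
    linarith
  rw [hdiff, norm_neg, le_div_iff₀ (sub_pos.2 hn)]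
  calc ‖Td * S * X‖ * (1 - ‖Td * S‖)
      ≤ ‖Td‖ * ‖S‖ * ‖X‖ * (1 - ‖Td * S‖) := by
        have := sub_pos.2 hn
        gcongr
        exact (norm_mul_le _ _).trans (by gcongr; exact norm_mul_le _ _)
    _ = ‖Td‖ * ‖S‖ * (‖X‖ * (1 - ‖Td * S‖)) := by ring
    _ ≤ ‖Td‖ * ‖S‖ * ‖Td‖ := by gcongr
    _ = ‖S‖ * ‖Td‖ ^ 2 := by ring
end
end

section
/- Let T be an accretive operator on a complex Hilbert space H such that T² is m-accretive. Then T is m-accretive. -/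
open scoped ComplexInnerProductSpace
noncomputable section

variable {H : Type*} [NormedAddCommGroup H] [InnerProductSpace ℂ H] [CompleteSpace H]

/-- If `T * T + 1` is surjective, then so is `T + i`, as `T * T + 1 = (T + i) (T - i)`. -/
lemma IsSquareOf.exists_add_I_smul_eq {E : Type*} [NormedAddCommGroup E]
    [InnerProductSpace ℂ E] {T T2 : E →ₗ.[ℂ] E} (hsq : IsSquareOf T T2)
    (h : ∀ y : E, ∃ x : T2.domain, (x : E) + T2 x = y) (y : E) :
    ∃ x : T.domain, T x + Complex.I • (x : E) = y := by
  obtain ⟨x, hx⟩ := h y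
  obtain ⟨h1, h2, h3⟩ := hsq.1 x
  refine ⟨⟨T ⟨x, h1⟩, h2⟩ - Complex.I • ⟨x, h1⟩, ?_⟩
  rw [LinearPMap.map_sub, LinearPMap.map_smul, ← hx, h3]
  simp only [Submodule.coe_sub, Submodule.coe_smul, smul_sub, smul_smul, Complex.I_mul_I]
  module

/-- The numerical range of the closure of an accretive operator lies in the closed right
half-plane. -/
lemma PAccretive.re_inner_nonneg_of_mem_closure {E : Type*} [NormedAddCommGroup E]
    [InnerProductSpace ℂ E] {T : E →ₗ.[ℂ] E} (hT : PAccretive T) {p : E × E}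
    (hp : p ∈ T.graph.topologicalClosure) : 0 ≤ (⟪p.1, p.2⟫).re := by
  have hcl : IsClosed {q : E × E | 0 ≤ (⟪q.1, q.2⟫).re} :=
    isClosed_le continuous_const (Complex.continuous_re.comp (continuous_fst.inner continuous_snd))
  refine closure_minimal (fun q hq => ?_) hcl hp
  obtain ⟨x, hx1, hx2⟩ := (LinearPMap.mem_graph_iff T).1 hq
  have := hT x
  rwa [hx1, hx2] at this

/-- An accretive operator `T` such that `T + i` is surjective is closed. -/
lemma PAccretive.isClosed_graph {E : Type*} [NormedAddCommGroup E]
    [InnerProductSpace ℂ E] {T : E →ₗ.[ℂ] E} (hT : PAccretive T)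
    (hs : ∀ y : E, ∃ x : T.domain, T x + Complex.I • (x : E) = y) :
    IsClosed (T.graph : Set (E × E)) := by
  have mem (x : T.domain) : ((x : E), T x) ∈ T.graph.topologicalClosure :=
    T.graph.le_topologicalClosure (T.mem_graph x)
  refine isClosed_of_closure_subset ?_
  rintro ⟨x, y⟩ hxy
  change (x, y) ∈ T.graph.topologicalClosure at hxy
  obtain ⟨z, hz⟩ := hs (y + Complex.I • x)
  obtain ⟨v, hv⟩ := hs (x - z)
  set w : E := x - z with hw
  have hTz : T z = y + Complex.I • w := by
    rw [eq_sub_of_add_eq hz, hw]; module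
  have hTv : T v = w - Complex.I • (v : E) := eq_sub_of_add_eq hv
  have key (t : ℝ) (ht : 0 < t) : ‖w‖ ^ 2 ≤ t * (⟪(v : E), w⟫).re := by
    have h := hT.re_inner_nonneg_of_mem_closure
      (Submodule.sub_mem _ (Submodule.sub_mem _ hxy (mem z))
        (Submodule.smul_mem _ (t : ℂ) (mem v)))
    have e1 : ((x, y) - ((z : E), T z) - (t : ℂ) • ((v : E), T v)).1 = w - (t : ℂ) • (v : E) := rfl
    have e2 : ((x, y) - ((z : E), T z) - (t : ℂ) • ((v : E), T v)).2
        = -((t : ℂ) • w) - Complex.I • (w - (t : ℂ) • (v : E)) := by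
      change y - T z - (t : ℂ) • T v = _
      rw [hTz, hTv]; module
    rw [e1, e2, inner_sub_right, inner_smul_right _ _ Complex.I,
      inner_self_eq_norm_sq_to_K, inner_neg_right, inner_smul_right, inner_sub_left,
      inner_smul_left, inner_self_eq_norm_sq_to_K] at h
    simp [← Complex.ofReal_pow] at h
    nlinarith
  have hw0 : w = 0 := by
    by_contra hne
    have ha : 0 < ‖w‖ ^ 2 := by positivity
    set b := (⟪(v : E), w⟫).re
    have h := key (‖w‖ ^ 2 / (2 * (|b| + 1))) (by positivity)
    rw [div_mul_eq_mul_div, le_div_iff₀ (by positivity)] at h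
    nlinarith [le_abs_self b, abs_nonneg b]
  refine (LinearPMap.mem_graph_iff T).2 ⟨z, (sub_eq_zero.1 hw0).symm, ?_⟩
  simp [hTz, hw0]

/-- An accretive operator `T` such that `T + i` is surjective satisfies `R(μ + T) = H` for every
`μ > 0`. -/
lemma PAccretive.exists_smul_add_eq {T : H →ₗ.[ℂ] H} (hT : PAccretive T)
    (hs : ∀ y : H, ∃ x : T.domain, T x + Complex.I • (x : H) = y) {μ : ℝ} (hμ : 0 < μ) (y : H) :
    ∃ x : T.domain, (μ : ℂ) • (x : H) + T x = y := by
  have hcomplete : CompleteSpace T.graph := (hT.isClosed_graph hs).completeSpace_coe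
  let f : T.graph →L[ℂ] H :=
    ((μ : ℂ) • ContinuousLinearMap.fst ℂ H H + ContinuousLinearMap.snd ℂ H H).comp T.graph.subtypeL
  have hf (p : T.graph) : f p = (μ : ℂ) • (p : H × H).1 + (p : H × H).2 := rfl
  have bound1 (p : T.graph) : μ * ‖(p : H × H).1‖ ≤ ‖f p‖ := by
    have h0 := hT.re_inner_nonneg_of_mem_closure (T.graph.le_topologicalClosure p.2)
    have h1 : (⟪(p : H × H).1, f p⟫).re
        = μ * ‖(p : H × H).1‖ ^ 2 + (⟪(p : H × H).1, (p : H × H).2⟫).re := by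
      rw [hf, inner_add_right, inner_smul_right, inner_self_eq_norm_sq_to_K]
      simp [← Complex.ofReal_pow]
    have h2 := (Complex.re_le_norm _).trans (norm_inner_le_norm (𝕜 := ℂ) (p : H × H).1 (f p))
    rcases (norm_nonneg (p : H × H).1).eq_or_lt with h | h
    · rw [← h, mul_zero]; exact norm_nonneg _
    · refine le_of_mul_le_mul_left ?_ h
      nlinarith
  have bound2 (p : T.graph) : ‖(p : H × H).2‖ ≤ 2 * ‖f p‖ := by
    have h : (p : H × H).2 = f p - (μ : ℂ) • (p : H × H).1 := by rw [hf]; module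
    have h' := norm_sub_le (f p) ((μ : ℂ) • (p : H × H).1)
    rw [← h, norm_smul, Complex.norm_real, Real.norm_of_nonneg hμ.le] at h'
    linarith [bound1 p]
  have hanti : AntilipschitzWith (Real.toNNReal (μ⁻¹ + 2)) f := by
    refine AddMonoidHomClass.antilipschitz_of_bound f fun p => ?_
    rw [Real.coe_toNNReal _ (by positivity)]
    have hnn := norm_nonneg (f p)
    have hinv : 0 < μ⁻¹ := inv_pos.2 hμ
    refine max_le ?_ ?_
    · have : ‖(p : H × H).1‖ ≤ μ⁻¹ * ‖f p‖ := (le_inv_mul_iff₀ hμ).2 (bound1 p)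
      change ‖(p : H × H).1‖ ≤ _
      linarith
    · change ‖(p : H × H).2‖ ≤ _
      nlinarith [bound2 p]
  have hclosed : IsClosed (f.range : Set H) := hanti.isClosed_range f.uniformContinuous
  have hcompl : CompleteSpace f.range := hclosed.completeSpace_coe
  have htop : f.range = ⊤ := by
    refine (Submodule.orthogonal_eq_bot_iff).1 ((Submodule.eq_bot_iff _).2 fun z hz => ?_)
    obtain ⟨w, rfl⟩ := hs z
    set z : H := T w + Complex.I • (w : H) with hz'
    have h1 := (Submodule.mem_orthogonal' _ _).1 hz (f ⟨(w, T w), T.mem_graph w⟩) ⟨_, rfl⟩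
    have h2 : f ⟨(w, T w), T.mem_graph w⟩ = z + ((μ : ℂ) - Complex.I) • (w : H) := by
      rw [hf, hz']; module
    have h3 : 0 ≤ (⟪z, (w : H)⟫).re := by
      have := hT w
      rw [← Complex.conj_re, inner_conj_symm] at this
      rw [hz', inner_add_left, inner_smul_left, inner_self_eq_norm_sq_to_K]
      simpa [← Complex.ofReal_pow] using this
    rw [h2, inner_add_right, inner_smul_right, inner_self_eq_norm_sq_to_K] at h1
    have hre := congrArg Complex.re h1
    have him := congrArg Complex.im h1
    simp [← Complex.ofReal_pow] at hre him
    have h4 : ‖z‖ ^ 2 ≤ 0 := by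
      have him' : 0 ≤ (⟪z, (w : H)⟫).im := nonneg_of_mul_nonneg_right (by linarith) hμ
      nlinarith
    exact norm_eq_zero.1 (pow_eq_zero_iff two_ne_zero |>.1 (le_antisymm h4 (sq_nonneg _)))
  obtain ⟨⟨p, hp⟩, hpy⟩ : y ∈ f.range := htop ▸ Submodule.mem_top
  obtain ⟨x, hx1, hx2⟩ := (LinearPMap.mem_graph_iff T).1 hp
  exact ⟨x, by rw [hx1, hx2]; exact hpy⟩

theorem stmt_13 (T T2 : H →ₗ.[ℂ] H) (hT : PAccretive T) (hsq : IsSquareOf T T2)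
    (h2 : MAccretive T2) : MAccretive T := by
  have hs := hsq.exists_add_I_smul_eq fun y => by simpa using h2.2.2.2 1 one_pos y
  exact ⟨hT, h2.2.1.mono fun x hx => ((hsq.2 x).1 hx).1, hT.isClosed_graph hs,
    fun μ hμ y => hT.exists_smul_add_eq hs hμ y⟩
end
end
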